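/- arXiv:1804.06663 — 4 statements merged into one kernel-verified Lean document; each statement's English description precedes it below -/
import Mathlib

section
/- Let ξ be an approximate block design with r_0(ξ) = 1/2 (equivalently Σ_{i=1}^{v} r_i(ξ) = 1/2). Then the smallest eigenvalue of N(ξ) satisfies λ_min(N(ξ)) ≤ 1/(2v) − (1/v) Σ_{k=1}^{d} ξ(0,k)^2 / s_k(ξ), and moreover λ_min(N(ξ)) ≤ 1/(4v), with the bound Σ_{k=1}^{d} ξ(0,k)^2/s_k(ξ) ≥ 1/4 attained as equality if and only if ξ(0,k) = s_k(ξ)/2 for all k. -/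
open Matrix BigOperators Finset

/-- An approximate block design for `v` test treatments (labelled `1,…,v`, with
treatment `0` the control) and `d` blocks: a nonnegative weight function on
treatment-block pairs summing to one, with every block receiving positive mass. -/
structure ApproxDesign (v d : ℕ) where
  w : Fin (v + 1) → Fin d → ℝ
  nonneg : ∀ i k, 0 ≤ w i k
  le_one : ∀ i k, w i k ≤ 1
  sum_one : ∑ i, ∑ k, w i k = 1
  blockPos : ∀ k, 0 < ∑ i, w i k

namespace ApproxDesign

variable {v d : ℕ}

/-- Block sizes `s_k(ξ)`. -/
noncomputable def s (ξ : ApproxDesign v d) (k : Fin d) : ℝ := ∑ i, ξ.w i k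

/-- Treatment replications `r_i(ξ)`. -/
noncomputable def r (ξ : ApproxDesign v d) (i : Fin (v + 1)) : ℝ := ∑ k, ξ.w i k

/-- The information matrix `N(ξ) = diag(r_1,…,r_v) − Z diag(s⁻¹) Zᵀ` for comparing
the test treatments with the control. -/
noncomputable def N (ξ : ApproxDesign v d) : Matrix (Fin v) (Fin v) ℝ :=
  Matrix.of fun i j =>
    (if i = j then ξ.r i.succ else 0) - ∑ k, ξ.w i.succ k * ξ.w j.succ k / ξ.s k

end ApproxDesign

/-- The smallest eigenvalue of a real matrix, as the infimum of its spectrum. -/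
noncomputable def lamMin {n : ℕ} (A : Matrix (Fin n) (Fin n) ℝ) : ℝ :=
  sInf (spectrum ℝ A)

/-- The Rayleigh quotient bound: `λ_min(A) ‖x‖² ≤ xᵀ A x` for symmetric `A`. -/
theorem lamMin_mul_dotProduct_le {n : ℕ} {A : Matrix (Fin n) (Fin n) ℝ}
    (hA : A.IsHermitian) (x : Fin n → ℝ) : lamMin A * (x ⬝ᵥ x) ≤ x ⬝ᵥ (A *ᵥ x) := by
  have hfin : (spectrum ℝ A).Finite := by
    rw [hA.spectrum_real_eq_range_eigenvalues]
    exact Set.finite_range _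
  have hpos : (A - algebraMap ℝ _ (lamMin A)).PosSemidef := by
    refine Matrix.posSemidef_iff_isHermitian_and_spectrum_nonneg.2 ⟨?_, ?_⟩
    · refine hA.sub ?_
      rw [Matrix.algebraMap_eq_diagonal]
      exact Matrix.isHermitian_diagonal _
    · intro μ hμ
      rw [← spectrum.sub_singleton_eq] at hμ
      obtain ⟨ν, hν, c, rfl, rfl⟩ := Set.mem_sub.1 hμ
      exact sub_nonneg.2 (csInf_le hfin.bddBelow hν)
  have h := hpos.dotProduct_mulVec_nonneg x
  rw [Matrix.sub_mulVec, dotProduct_sub, Algebra.algebraMap_eq_smul_one, Matrix.smul_mulVec,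
    Matrix.one_mulVec, dotProduct_smul, star_trivial, smul_eq_mul] at h
  linarith

namespace ApproxDesign

variable {v d : ℕ}

theorem s_pos (ξ : ApproxDesign v d) (k : Fin d) : 0 < ξ.s k := ξ.blockPos k

theorem sum_s (ξ : ApproxDesign v d) : ∑ k, ξ.s k = 1 := by
  simp only [s]
  rw [Finset.sum_comm]
  exact ξ.sum_one

theorem sum_w_succ (ξ : ApproxDesign v d) (k : Fin d) :
    ∑ i : Fin v, ξ.w i.succ k = ξ.s k - ξ.w 0 k := by
  rw [s, Fin.sum_univ_succ]
  ring

theorem sum_r_succ (ξ : ApproxDesign v d) : ∑ i : Fin v, ξ.r i.succ = 1 - ξ.r 0 := by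
  have h : ∑ i, ξ.r i = 1 := ξ.sum_one
  rw [Fin.sum_univ_succ] at h
  linarith

theorem N_isHermitian (ξ : ApproxDesign v d) : ξ.N.IsHermitian := by
  ext i j
  rw [Matrix.conjTranspose_apply, star_trivial]
  simp only [N, Matrix.of_apply, mul_comm (ξ.w j.succ _)]
  congr 1
  by_cases h : i = j
  · simp [h]
  · simp [h, Ne.symm h]

/-- The sum of the entries of the information matrix. -/
theorem one_dotProduct_N_mulVec_one (ξ : ApproxDesign v d) :
    1 ⬝ᵥ (ξ.N *ᵥ 1) = ξ.r 0 - ∑ k, ξ.w 0 k ^ 2 / ξ.s k := by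
  have hblock : ∀ k, ∑ i : Fin v, ∑ j : Fin v, ξ.w i.succ k * ξ.w j.succ k / ξ.s k =
      ξ.s k - 2 * ξ.w 0 k + ξ.w 0 k ^ 2 / ξ.s k := by
    intro k
    have hs := (ξ.s_pos k).ne'
    simp_rw [← Finset.sum_div, ← Finset.sum_mul_sum, sum_w_succ]
    field_simp
    ring
  have hcomm : ∑ i : Fin v, ∑ j : Fin v, ∑ k, ξ.w i.succ k * ξ.w j.succ k / ξ.s k =
      ∑ k, ∑ i : Fin v, ∑ j : Fin v, ξ.w i.succ k * ξ.w j.succ k / ξ.s k := by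
    rw [Finset.sum_comm]
    simp_rw [Finset.sum_comm (s := (Finset.univ : Finset (Fin d)))]
    rw [Finset.sum_comm]
  have hr : ∑ k, ξ.w 0 k = ξ.r 0 := rfl
  simp only [one_dotProduct, Matrix.mulVec, dotProduct_one, N, Matrix.of_apply, Finset.sum_sub_distrib,
    Finset.sum_ite_eq, Finset.mem_univ, if_true, sum_r_succ]
  rw [hcomm]
  simp only [hblock, Finset.sum_add_distrib, Finset.sum_sub_distrib, ← Finset.mul_sum, sum_s, hr]
  ring

theorem sum_sq_sub_half_div (ξ : ApproxDesign v d) :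
    ∑ k, (ξ.w 0 k - ξ.s k / 2) ^ 2 / ξ.s k =
      ∑ k, ξ.w 0 k ^ 2 / ξ.s k - ξ.r 0 + 1 / 4 := by
  have hblock : ∀ k, (ξ.w 0 k - ξ.s k / 2) ^ 2 / ξ.s k =
      ξ.w 0 k ^ 2 / ξ.s k - ξ.w 0 k + 1 / 4 * ξ.s k := by
    intro k
    have hs := (ξ.s_pos k).ne'
    field_simp
    ring
  simp only [hblock, Finset.sum_add_distrib, Finset.sum_sub_distrib, ← Finset.mul_sum, sum_s,
    mul_one, r]

end ApproxDesign

/-- If the control receives total weight `1/2`, then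
`λ_min(N(ξ)) ≤ 1/(2v) − (1/v) Σ_k ξ(0,k)²/s_k ≤ 1/(4v)`; moreover
`Σ_k ξ(0,k)²/s_k ≥ 1/4` with equality iff `ξ(0,k) = s_k/2` for all `k`. -/
theorem lamMin_upper_bound {v d : ℕ} (hv : 1 ≤ v) (hd : 1 ≤ d)
    (ξ : ApproxDesign v d) (hr0 : ξ.r 0 = 1 / 2) :
    lamMin (ApproxDesign.N ξ) ≤
        1 / (2 * (v : ℝ)) - (1 / (v : ℝ)) * ∑ k, (ξ.w 0 k) ^ 2 / ξ.s k ∧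
    lamMin (ApproxDesign.N ξ) ≤ 1 / (4 * (v : ℝ)) ∧
    (1 / 4 : ℝ) ≤ ∑ k, (ξ.w 0 k) ^ 2 / ξ.s k ∧
    ((∑ k, (ξ.w 0 k) ^ 2 / ξ.s k = 1 / 4) ↔ ∀ k, ξ.w 0 k = ξ.s k / 2) := by
  have hv0 : (0 : ℝ) < v := by exact_mod_cast hv
  have hnonneg : ∀ k, 0 ≤ (ξ.w 0 k - ξ.s k / 2) ^ 2 / ξ.s k := fun k =>
    div_nonneg (sq_nonneg _) (ξ.s_pos k).le
  have hsum := ξ.sum_sq_sub_half_div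
  have hquarter : (1 / 4 : ℝ) ≤ ∑ k, (ξ.w 0 k) ^ 2 / ξ.s k := by
    have h := Finset.sum_nonneg fun k (_ : k ∈ Finset.univ) => hnonneg k
    linarith
  have hray : lamMin ξ.N * v ≤ 1 / 2 - ∑ k, (ξ.w 0 k) ^ 2 / ξ.s k := by
    have h := lamMin_mul_dotProduct_le ξ.N_isHermitian 1
    rw [ξ.one_dotProduct_N_mulVec_one, hr0] at h
    simpa using h
  refine ⟨?_, ?_, hquarter, ?_⟩
  · calc lamMin ξ.N ≤ (1 / 2 - ∑ k, (ξ.w 0 k) ^ 2 / ξ.s k) / v := (le_div_iff₀ hv0).2 hray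
      _ = _ := by field_simp
  · calc lamMin ξ.N ≤ (1 / 4) / v := (le_div_iff₀ hv0).2 (by linarith)
      _ = _ := by field_simp
  · have hiff : ∑ k, (ξ.w 0 k) ^ 2 / ξ.s k = 1 / 4 ↔
        ∑ k, (ξ.w 0 k - ξ.s k / 2) ^ 2 / ξ.s k = 0 := by
      constructor <;> intro h <;> linarith
    rw [hiff, Finset.sum_eq_zero_iff_of_nonneg fun k _ => hnonneg k]
    simp [(ξ.s_pos _).ne', sub_eq_zero]
end

section
/- For every approximate block design ξ, the smallest eigenvalue of N(ξ) is at most 1/(4v); that is, the optimal E-criterion value over all approximate block designs equals 1/(4v). -/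
open Matrix BigOperators Finset

theorem lamMin_le_of_mem_spectrum {n : ℕ} (A : Matrix (Fin n) (Fin n) ℝ) {μ : ℝ}
    (hμ : μ ∈ spectrum ℝ A) : lamMin A ≤ μ :=
  csInf_le (Matrix.finite_real_spectrum (A := A)).bddBelow hμ

/-- A real number is in the spectrum of a real matrix iff it has an eigenvector. -/
theorem mem_spectrum_iff_exists_mulVec {n : ℕ} (A : Matrix (Fin n) (Fin n) ℝ) (μ : ℝ) :
    μ ∈ spectrum ℝ A ↔ ∃ x : Fin n → ℝ, x ≠ 0 ∧ A *ᵥ x = μ • x := by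
  rw [spectrum.mem_iff, Matrix.isUnit_iff_isUnit_det, isUnit_iff_ne_zero, not_not,
    ← Matrix.exists_mulVec_eq_zero_iff]
  refine exists_congr fun x => and_congr_right fun _ => ?_
  rw [Matrix.sub_mulVec, sub_eq_zero, Algebra.algebraMap_eq_smul_one, Matrix.smul_mulVec,
    Matrix.one_mulVec, eq_comm]

/-- The Rayleigh quotient bound at the all-ones vector. -/
theorem lamMin_mul_card_le_sum {n : ℕ} {A : Matrix (Fin n) (Fin n) ℝ} (hA : A.IsHermitian) :
    lamMin A * n ≤ ∑ i, ∑ j, A i j := by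
  have hone : (algebraMap ℝ (Matrix (Fin n) (Fin n) ℝ) (lamMin A)).IsHermitian := by
    rw [Algebra.algebraMap_eq_smul_one]
    simp [Matrix.IsHermitian]
  have hpsd : (A - algebraMap ℝ _ (lamMin A)).PosSemidef := by
    refine Matrix.posSemidef_iff_isHermitian_and_spectrum_nonneg.mpr ⟨hA.sub hone, ?_⟩
    intro μ hμ
    rw [mem_spectrum_iff_exists_mulVec] at hμ
    obtain ⟨x, hx, h⟩ := hμ
    have hmem : lamMin A + μ ∈ spectrum ℝ A := by
      rw [mem_spectrum_iff_exists_mulVec]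
      refine ⟨x, hx, ?_⟩
      rw [Matrix.sub_mulVec, Algebra.algebraMap_eq_smul_one, Matrix.smul_mulVec,
        Matrix.one_mulVec, sub_eq_iff_eq_add] at h
      rw [h, add_smul, add_comm]
    have := lamMin_le_of_mem_spectrum A hmem
    change 0 ≤ μ
    linarith
  have h := hpsd.dotProduct_mulVec_nonneg (fun _ => 1)
  rw [Matrix.sub_mulVec, Algebra.algebraMap_eq_smul_one, Matrix.smul_mulVec,
    Matrix.one_mulVec] at h
  simp only [dotProduct, Matrix.mulVec, Finset.sum_sub_distrib, star_trivial, Pi.star_apply,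
    Pi.sub_apply, Pi.smul_apply, smul_eq_mul, one_mul, mul_one, Finset.sum_const,
    Finset.card_univ, Fintype.card_fin, nsmul_eq_mul] at h
  linarith

namespace ApproxDesign

theorem isHermitian_N {v d : ℕ} (ξ : ApproxDesign v d) : ξ.N.IsHermitian := by
  ext i j
  simp only [Matrix.conjTranspose_apply, star_trivial, N, Matrix.of_apply, eq_comm (a := j),
    mul_comm (ξ.w j.succ _)]
  by_cases h : i = j
  · subst h; rfl
  · simp [h]

theorem sum_N_le {v d : ℕ} (ξ : ApproxDesign v d) : ∑ i, ∑ j, ξ.N i j ≤ 1 / 4 := by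
  have hblock (k : Fin d) : ∑ i : Fin v, ξ.w i.succ k = ξ.s k - ξ.w 0 k := by
    rw [s, Fin.sum_univ_succ]; ring
  have hquad : ∑ i : Fin v, ∑ j : Fin v, ∑ k, ξ.w i.succ k * ξ.w j.succ k / ξ.s k =
      ∑ k, (ξ.s k - ξ.w 0 k) ^ 2 / ξ.s k := by
    simp_rw [Finset.sum_comm (s := (univ : Finset (Fin v))) (t := (univ : Finset (Fin d)))]
    refine Finset.sum_congr rfl fun k _ => ?_
    simp_rw [← Finset.sum_div, ← Finset.mul_sum, ← Finset.sum_mul, hblock]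
    ring
  have hlin : ∑ i : Fin v, ξ.r i.succ = ∑ k, (ξ.s k - ξ.w 0 k) := by
    simp_rw [r]
    rw [Finset.sum_comm]
    simp_rw [hblock]
  have hs : ∑ k, ξ.s k = 1 := by
    simp_rw [s]
    rw [Finset.sum_comm, ξ.sum_one]
  simp only [N, Matrix.of_apply, Finset.sum_sub_distrib, Finset.sum_ite_eq, Finset.mem_univ,
    if_true]
  rw [hquad, hlin, ← Finset.sum_sub_distrib, ← hs, Finset.sum_div]
  refine Finset.sum_le_sum fun k _ => ?_
  have hk : 0 < ξ.s k := ξ.blockPos k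
  rw [sub_le_iff_le_add, ← sub_le_iff_le_add', le_div_iff₀ hk]
  nlinarith [sq_nonneg (ξ.s k - 2 * ξ.w 0 k)]

theorem lamMin_N_le {v d : ℕ} (hv : 1 ≤ v) (ξ : ApproxDesign v d) :
    lamMin ξ.N ≤ 1 / (4 * (v : ℝ)) := by
  have hv' : (0 : ℝ) < v := by exact_mod_cast hv
  have h := (lamMin_mul_card_le_sum ξ.isHermitian_N).trans ξ.sum_N_le
  rw [le_div_iff₀ (by positivity)]
  linarith

/-- The product design giving weight one half to the control and spreading the other half
uniformly over the test treatments, with uniform block sizes. -/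
noncomputable def balanced (v d : ℕ) (hv : 1 ≤ v) (hd : 1 ≤ d) : ApproxDesign v d :=
  have hv' : (1 : ℝ) ≤ v := by exact_mod_cast hv
  have hd' : (1 : ℝ) ≤ d := by exact_mod_cast hd
  { w := fun i _ => Fin.cases (1 / (2 * (d : ℝ))) (fun _ => 1 / (2 * (d : ℝ) * v)) i
    nonneg := fun i k => by
      cases i using Fin.cases <;> simp only [Fin.cases_zero, Fin.cases_succ] <;> positivity
    le_one := fun i k => by
      cases i using Fin.cases with
      | zero =>
        rw [Fin.cases_zero, div_le_one (by positivity)]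
        linarith
      | succ i =>
        rw [Fin.cases_succ, div_le_one (by positivity)]
        nlinarith
    sum_one := by
      simp only [Fin.sum_univ_succ, Fin.cases_zero, Fin.cases_succ, Finset.sum_const,
        Finset.card_univ, Fintype.card_fin, nsmul_eq_mul]
      field_simp
      norm_num
    blockPos := fun k => by
      simp only [Fin.sum_univ_succ, Fin.cases_zero, Fin.cases_succ, Finset.sum_const,
        Finset.card_univ, Fintype.card_fin, nsmul_eq_mul]
      positivity }

theorem balanced_N_apply {v d : ℕ} (hv : 1 ≤ v) (hd : 1 ≤ d) (i j : Fin v) :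
    (balanced v d hv hd).N i j =
      (if i = j then 1 / (2 * (v : ℝ)) else 0) - 1 / (4 * (v : ℝ) ^ 2) := by
  have hv' : (0 : ℝ) < v := by exact_mod_cast hv
  have hd' : (0 : ℝ) < d := by exact_mod_cast hd
  simp only [N, r, s, balanced, Matrix.of_apply, Fin.sum_univ_succ, Fin.cases_zero,
    Fin.cases_succ, Finset.sum_const, Finset.card_univ, Fintype.card_fin, nsmul_eq_mul]
  congr 1
  · congr 1
    field_simp
  · field_simp
    norm_num

theorem balanced_N_mulVec {v d : ℕ} (hv : 1 ≤ v) (hd : 1 ≤ d) (x : Fin v → ℝ) (i : Fin v) :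
    ((balanced v d hv hd).N *ᵥ x) i =
      1 / (2 * (v : ℝ)) * x i - 1 / (4 * (v : ℝ) ^ 2) * ∑ j, x j := by
  simp only [Matrix.mulVec, dotProduct, balanced_N_apply, sub_mul, ite_mul, zero_mul,
    Finset.sum_sub_distrib, Finset.sum_ite_eq, Finset.mem_univ, if_true, Finset.mul_sum]

theorem lamMin_balanced_N {v d : ℕ} (hv : 1 ≤ v) (hd : 1 ≤ d) :
    lamMin (balanced v d hv hd).N = 1 / (4 * (v : ℝ)) := by
  have hv' : (0 : ℝ) < v := by exact_mod_cast hv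
  refine IsLeast.csInf_eq ⟨?_, fun μ hμ => ?_⟩
  · rw [mem_spectrum_iff_exists_mulVec]
    refine ⟨fun _ => 1, fun h => one_ne_zero (congrFun h ⟨0, hv⟩), ?_⟩
    ext i
    rw [balanced_N_mulVec]
    simp only [Finset.sum_const, Finset.card_univ, Fintype.card_fin, nsmul_eq_mul,
      Pi.smul_apply, smul_eq_mul]
    field_simp
    norm_num
  · obtain ⟨x, hx, h⟩ := (mem_spectrum_iff_exists_mulVec _ _).mp hμ
    have hcoord (i : Fin v) :
        1 / (2 * (v : ℝ)) * x i - 1 / (4 * (v : ℝ) ^ 2) * ∑ j, x j = μ * x i := by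
      rw [← balanced_N_mulVec hv hd, h, Pi.smul_apply, smul_eq_mul]
    by_cases hsum : ∑ j, x j = 0
    · obtain ⟨i, hi⟩ := Function.ne_iff.mp hx
      have hi' := hcoord i
      rw [hsum, mul_zero, sub_zero] at hi'
      rw [← mul_right_cancel₀ hi hi']
      gcongr
      norm_num
    · have htotal := Finset.sum_congr rfl fun i (_ : i ∈ univ) => hcoord i
      rw [Finset.sum_sub_distrib, ← Finset.mul_sum, ← Finset.mul_sum, Finset.sum_const,
        Finset.card_univ, Fintype.card_fin, nsmul_eq_mul] at htotal
      refine le_of_eq (mul_right_cancel₀ hsum ?_)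
      rw [Finset.mul_sum univ x μ, ← htotal]
      field_simp
      norm_num

end ApproxDesign

/-- Every approximate block design has `λ_min(N(ξ)) ≤ 1/(4v)`, and this
optimal E-criterion value is attained, i.e. the optimal value equals `1/(4v)`. -/
theorem optimal_E_value {v d : ℕ} (hv : 1 ≤ v) (hd : 1 ≤ d) :
    (∀ ξ : ApproxDesign v d, lamMin (ApproxDesign.N ξ) ≤ 1 / (4 * (v : ℝ))) ∧
    (∃ ξ : ApproxDesign v d, lamMin (ApproxDesign.N ξ) = 1 / (4 * (v : ℝ))) := by
  exact ⟨ApproxDesign.lamMin_N_le hv,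
    ApproxDesign.balanced v d hv hd, ApproxDesign.lamMin_balanced_N hv hd⟩
end

section
/- Let ξ* be an E-optimal approximate block design for treatment-control comparisons (ξ* maximizes λ_min(N(ξ)) over all approximate block designs), with v ≥ 2. Then ξ* is feasible and ξ* minimizes 1_v^T N(ξ)^{−1} 1_v over all feasible approximate block designs ξ; equivalently, ξ* minimizes the variance of the least squares estimator of (Σ_{i=1}^v τ_i)/v − τ_0, i.e., ξ* is c-optimal for the contrast vector c̃ = (−1, 1/v, …, 1/v)^T. -/
open Matrix BigOperators Finset

/-- A real Hermitian matrix has smallest eigenvalue at least `c` iff subtracting `c` times the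
identity leaves it positive semidefinite. -/
theorem le_lamMin_iff {n : ℕ} [NeZero n] {A : Matrix (Fin n) (Fin n) ℝ} (hA : A.IsHermitian)
    (c : ℝ) : c ≤ lamMin A ↔ (A - c • (1 : Matrix (Fin n) (Fin n) ℝ)).PosSemidef := by
  have hs : spectrum ℝ A = Set.range hA.eigenvalues := hA.spectrum_real_eq_range_eigenvalues
  have hbdd : BddBelow (spectrum ℝ A) := hs ▸ (Set.finite_range _).bddBelow
  have hne : (spectrum ℝ A).Nonempty := hs ▸ Set.range_nonempty _
  have hH : (A - c • (1 : Matrix (Fin n) (Fin n) ℝ)).IsHermitian :=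
    hA.sub (Matrix.isHermitian_one.smul (IsSelfAdjoint.all c))
  rw [lamMin, le_csInf_iff hbdd hne, posSemidef_iff_isHermitian_and_spectrum_nonneg,
    and_iff_right hH, ← Algebra.algebraMap_eq_smul_one, ← spectrum.sub_singleton_eq]
  simp [Set.subset_def]

/-- For positive definite `A` and any real `c`, the lower bound on `1ᵀ A⁻¹ 1`
obtained from `(A⁻¹ 1 - c 1)ᵀ A (A⁻¹ 1 - c 1) ≥ 0`. -/
theorem Matrix.PosDef.le_one_dotProduct_inv_mulVec_one {n : ℕ} {A : Matrix (Fin n) (Fin n) ℝ}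
    (hA : A.PosDef) (c : ℝ) :
    2 * c * n - c ^ 2 * (1 ⬝ᵥ (A *ᵥ 1)) ≤ 1 ⬝ᵥ (A⁻¹ *ᵥ 1) := by
  have hx : A *ᵥ (A⁻¹ *ᵥ 1) = 1 := by
    rw [Matrix.mulVec_mulVec,
      Matrix.mul_nonsing_inv _ ((Matrix.isUnit_iff_isUnit_det _).1 hA.isUnit),
      Matrix.one_mulVec]
  set x := A⁻¹ *ᵥ (1 : Fin n → ℝ)
  have hsymm : x ⬝ᵥ (A *ᵥ 1) = n := by
    have hT : Aᵀ = A := by simpa using hA.isHermitian.eq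
    rw [Matrix.dotProduct_mulVec, ← Matrix.mulVec_transpose, hT, hx]
    simp [dotProduct]
  have h := hA.posSemidef.dotProduct_mulVec_nonneg (x - c • 1)
  rw [star_trivial, Matrix.mulVec_sub, Matrix.mulVec_smul, hx] at h
  simp only [sub_dotProduct, dotProduct_sub, smul_dotProduct, dotProduct_smul, smul_eq_mul,
    hsymm, dotProduct_comm x 1] at h
  have h1 : (1 : Fin n → ℝ) ⬝ᵥ 1 = n := by simp [dotProduct]
  rw [h1] at h
  linarith

namespace ApproxDesign

variable {v d : ℕ}

theorem one_dotProduct_N_mulVec_one_le (ξ : ApproxDesign v d) :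
    1 ⬝ᵥ (ξ.N *ᵥ 1) ≤ 1 / 4 := by
  have key : ∀ k, (∑ i : Fin v, ξ.w i.succ k)
      - (∑ i : Fin v, ξ.w i.succ k) * (∑ j : Fin v, ξ.w j.succ k) / ξ.s k ≤ ξ.s k / 4 := by
    intro k
    have hs : 0 < ξ.s k := ξ.blockPos k
    rw [sub_le_iff_le_add, ← sub_le_iff_le_add', le_div_iff₀ hs]
    nlinarith [sq_nonneg ((∑ i : Fin v, ξ.w i.succ k) - ξ.s k / 2)]
  have hsum : ∑ k, ξ.s k = 1 := by
    rw [← ξ.sum_one, Finset.sum_comm]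
    rfl
  calc 1 ⬝ᵥ (ξ.N *ᵥ 1)
      = ∑ k, ((∑ i : Fin v, ξ.w i.succ k)
        - (∑ i : Fin v, ξ.w i.succ k) * (∑ j : Fin v, ξ.w j.succ k) / ξ.s k) := by
        simp only [dotProduct, mulVec, N, of_apply, Pi.one_apply, mul_one, one_mul,
          Finset.sum_sub_distrib, Finset.sum_ite_eq, Finset.mem_univ, if_true, r]
        congr 1
        · exact Finset.sum_comm
        · simp only [Finset.sum_mul_sum, Finset.sum_div]
          rw [Finset.sum_comm (s := (univ : Finset (Fin d)))]
          exact Finset.sum_congr rfl fun _ _ => Finset.sum_comm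
    _ ≤ ∑ k, ξ.s k / 4 := Finset.sum_le_sum fun k _ => key k
    _ = 1 / 4 := by rw [← Finset.sum_div, hsum]

/-- The design giving half of each of the equally sized blocks to the control and the rest
uniformly to the test treatments. -/
noncomputable def uniform (hv : 1 ≤ v) (hd : 1 ≤ d) : ApproxDesign v d where
  w := Fin.cons (fun _ => 1 / (2 * d)) (fun _ _ => 1 / (2 * d * v))
  nonneg i k := by
    refine Fin.cases ?_ (fun i => ?_) i <;> simp only [Fin.cons_zero, Fin.cons_succ] <;> positivity
  le_one i k := by
    have hv' : (1 : ℝ) ≤ v := by exact_mod_cast hv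
    have hd' : (1 : ℝ) ≤ d := by exact_mod_cast hd
    refine Fin.cases ?_ (fun i => ?_) i <;> simp only [Fin.cons_zero, Fin.cons_succ]
    · rw [div_le_one (by positivity)]; linarith
    · rw [div_le_one (by positivity)]; nlinarith
  sum_one := by
    have hv' : (v : ℝ) ≠ 0 := by positivity
    have hd' : (d : ℝ) ≠ 0 := by positivity
    simp only [Fin.sum_univ_succ, Fin.cons_zero, Fin.cons_succ, sum_const, card_univ,
      Fintype.card_fin, nsmul_eq_mul]
    field_simp
    norm_num
  blockPos k := by
    simp only [Fin.sum_univ_succ, Fin.cons_zero, Fin.cons_succ]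
    positivity

theorem uniform_N_apply (hv : 1 ≤ v) (hd : 1 ≤ d) (i j : Fin v) :
    (uniform hv hd).N i j = (if i = j then 1 / (2 * v : ℝ) else 0) - 1 / (4 * v ^ 2) := by
  have hv' : (v : ℝ) ≠ 0 := by positivity
  have hd' : (d : ℝ) ≠ 0 := by positivity
  simp only [N, uniform, r, s, of_apply, Fin.sum_univ_succ, Fin.cons_zero, Fin.cons_succ,
    sum_const, card_univ, Fintype.card_fin, nsmul_eq_mul]
  congr 1
  · congr 1
    field_simp
  · field_simp
    norm_num

theorem le_lamMin_uniform (hv : 1 ≤ v) (hd : 1 ≤ d) :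
    1 / (4 * v : ℝ) ≤ lamMin (uniform hv hd).N := by
  have : NeZero v := ⟨by lia⟩
  have hv' : (0 : ℝ) < v := by positivity
  have hH := (uniform hv hd).N_isHermitian
  rw [le_lamMin_iff hH]
  refine .of_dotProduct_mulVec_nonneg
    (hH.sub (Matrix.isHermitian_one.smul (IsSelfAdjoint.all _))) fun x => ?_
  have hx : star x ⬝ᵥ (((uniform hv hd).N - (1 / (4 * v : ℝ)) • 1) *ᵥ x)
      = (v * ∑ i, x i ^ 2 - (∑ i, x i) ^ 2) / (4 * v ^ 2) := by
    have h1 : (uniform hv hd).N *ᵥ x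
        = fun i => 1 / (2 * v) * x i - 1 / (4 * v ^ 2) * ∑ j, x j := by
      ext i
      simp [mulVec, dotProduct, uniform_N_apply, sub_mul, Finset.sum_sub_distrib,
        Finset.mul_sum]
    rw [sub_mulVec, smul_mulVec, one_mulVec, h1]
    simp only [dotProduct, star_trivial, Pi.sub_apply, Pi.smul_apply, smul_eq_mul]
    have h2 : ∀ i, x i * (1 / (2 * v) * x i - 1 / (4 * v ^ 2) * ∑ j, x j - 1 / (4 * v) * x i)
        = 1 / (4 * v) * x i ^ 2 - x i * (1 / (4 * v ^ 2) * ∑ j, x j) := fun i => by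
      field_simp; ring
    simp_rw [h2]
    rw [Finset.sum_sub_distrib, ← Finset.mul_sum, ← Finset.sum_mul]
    field_simp
  rw [hx]
  have := sq_sum_le_card_mul_sum_sq (s := univ) (f := x)
  rw [card_univ, Fintype.card_fin] at this
  exact div_nonneg (sub_nonneg.2 this) (by positivity)

end ApproxDesign

/-- An E-optimal approximate block design (`v ≥ 2`) is feasible and
minimizes `1_vᵀ N(ξ)⁻¹ 1_v` over all feasible approximate block designs, i.e. it is
c-optimal for the contrast `(Σ_{i>0} τ_i)/v − τ_0`. -/
theorem Eopt_is_c_opt {v d : ℕ} (hv : 2 ≤ v) (hd : 1 ≤ d)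
    (ξs : ApproxDesign v d)
    (hopt : ∀ η : ApproxDesign v d,
      lamMin (ApproxDesign.N η) ≤ lamMin (ApproxDesign.N ξs)) :
    (ApproxDesign.N ξs).PosDef ∧
    ∀ ξ : ApproxDesign v d, (ApproxDesign.N ξ).PosDef →
      (fun _ => (1 : ℝ)) ⬝ᵥ ((ApproxDesign.N ξs)⁻¹ *ᵥ fun _ => (1 : ℝ)) ≤
        (fun _ => (1 : ℝ)) ⬝ᵥ ((ApproxDesign.N ξ)⁻¹ *ᵥ fun _ => (1 : ℝ)) := by
  have hv1 : 1 ≤ v := by lia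
  have : NeZero v := ⟨by lia⟩
  have hv' : (0 : ℝ) < v := by positivity
  have hB := (le_lamMin_iff ξs.N_isHermitian _).1
    ((ApproxDesign.le_lamMin_uniform hv1 hd).trans (hopt _))
  set c : ℝ := 1 / (4 * v) with hc
  have hc0 : 0 < c := by positivity
  have hpd : ξs.N.PosDef := by
    simpa using PosDef.posSemidef_add hB (PosDef.one.smul hc0)
  have hone : (1 : Fin v → ℝ) ⬝ᵥ 1 = v := by simp [dotProduct]
  have hker : (ξs.N - c • (1 : Matrix (Fin v) (Fin v) ℝ)) *ᵥ 1 = 0 := by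
    refine (hB.dotProduct_mulVec_zero_iff 1).1 (le_antisymm ?_ (hB.dotProduct_mulVec_nonneg _))
    have h1 := ξs.one_dotProduct_N_mulVec_one_le
    have h2 : c * v = 1 / 4 := by rw [hc]; field_simp
    rw [star_trivial, sub_mulVec, smul_mulVec, one_mulVec, dotProduct_sub, dotProduct_smul, hone,
      smul_eq_mul, h2]
    linarith
  have hN : ξs.N *ᵥ 1 = c • 1 := by
    rwa [sub_mulVec, smul_mulVec, one_mulVec, sub_eq_zero] at hker
  have hinv : ξs.N⁻¹ *ᵥ 1 = (4 * v : ℝ) • 1 := by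
    have h3 : (1 : Fin v → ℝ) = ξs.N *ᵥ ((4 * v : ℝ) • 1) := by
      rw [mulVec_smul, hN, smul_smul, hc, mul_one_div_cancel (by positivity), one_smul]
    conv_lhs => rw [h3]
    rw [mulVec_mulVec, nonsing_inv_mul _ ((isUnit_iff_isUnit_det _).1 hpd.isUnit), one_mulVec]
  refine ⟨hpd, fun ξ hξ => ?_⟩
  change 1 ⬝ᵥ (ξs.N⁻¹ *ᵥ 1) ≤ 1 ⬝ᵥ (ξ.N⁻¹ *ᵥ 1)
  rw [hinv, dotProduct_smul, hone, smul_eq_mul]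
  have h4 := hξ.le_one_dotProduct_inv_mulVec_one (4 * v)
  nlinarith [ξ.one_dotProduct_N_mulVec_one_le, sq_nonneg (v : ℝ)]
end

section
/- For every feasible approximate block design ξ, all off-diagonal entries of N(ξ) are nonpositive, and every entry of the inverse matrix N(ξ)^{−1} is nonnegative. -/
open Matrix BigOperators Finset

/-- A positive definite real matrix with nonpositive off-diagonal entries is monotone:
`0 ≤ A *ᵥ x` forces `0 ≤ x`. -/
theorem Matrix.PosDef.nonneg_of_mulVec_nonneg {n : Type*} [Fintype n] {A : Matrix n n ℝ}
    (hA : A.PosDef) (hoff : ∀ i j, i ≠ j → A i j ≤ 0) {x : n → ℝ} (hx : 0 ≤ A *ᵥ x) :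
    0 ≤ x := by
  set y : n → ℝ := fun i => max (-x i) 0 with hy
  have hy0 : ∀ i, 0 ≤ y i := fun i => le_max_right _ _
  have hyx : ∀ i, 0 ≤ y i + x i := fun i => by
    have := le_max_left (-x i) 0
    simp only [hy]
    linarith
  have hmul : ∀ i, y i * (y i + x i) = 0 := fun i => by
    rcases le_total (-x i) 0 with h | h
    · simp [hy, max_eq_right h]
    · simp [hy, max_eq_left h]
  have h_sum : y ⬝ᵥ (A *ᵥ (y + x)) ≤ 0 := by
    simp only [dotProduct, mulVec, Finset.mul_sum, Pi.add_apply]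
    refine Finset.sum_nonpos fun i _ => Finset.sum_nonpos fun j _ => ?_
    rcases eq_or_ne i j with rfl | hij
    · rw [mul_left_comm, hmul, mul_zero]
    · exact mul_nonpos_of_nonneg_of_nonpos (hy0 i)
        (mul_nonpos_of_nonpos_of_nonneg (hoff i j hij) (hyx j))
  have h_nonneg : 0 ≤ y ⬝ᵥ (A *ᵥ x) :=
    Finset.sum_nonneg fun i _ => mul_nonneg (hy0 i) (hx i)
  rw [mulVec_add, dotProduct_add] at h_sum
  have hyzero : y = 0 := by
    by_contra hne
    have hpos := hA.dotProduct_mulVec_pos hne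
    rw [star_trivial] at hpos
    linarith
  intro i
  simpa [hyzero] using hyx i

/-- The inverse of a positive definite real matrix with nonpositive off-diagonal entries is
entrywise nonnegative. -/
theorem Matrix.PosDef.inv_apply_nonneg {n : Type*} [Fintype n] [DecidableEq n]
    {A : Matrix n n ℝ} (hA : A.PosDef) (hoff : ∀ i j, i ≠ j → A i j ≤ 0) (i j : n) :
    0 ≤ A⁻¹ i j := by
  have hcol : 0 ≤ A⁻¹ *ᵥ Pi.single j 1 := by
    refine hA.nonneg_of_mulVec_nonneg hoff ?_
    rw [mulVec_mulVec, mul_nonsing_inv A ((isUnit_iff_isUnit_det A).mp hA.isUnit), one_mulVec]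
    exact Pi.single_nonneg.mpr zero_le_one
  simpa using hcol i

theorem ApproxDesign.N_apply_nonpos_of_ne {v d : ℕ} (ξ : ApproxDesign v d) {i j : Fin v}
    (hij : i ≠ j) : ξ.N i j ≤ 0 := by
  simp only [ApproxDesign.N, of_apply, if_neg hij, zero_sub, neg_nonpos]
  exact Finset.sum_nonneg fun k _ =>
    div_nonneg (mul_nonneg (ξ.nonneg _ k) (ξ.nonneg _ k)) (ξ.blockPos k).le

/-- For every feasible approximate block design, the off-diagonal entries
of `N(ξ)` are nonpositive and every entry of `N(ξ)⁻¹` is nonnegative. -/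
theorem Ninv_entries_nonneg {v d : ℕ} (hv : 1 ≤ v) (hd : 1 ≤ d)
    (ξ : ApproxDesign v d) (hfeas : (ApproxDesign.N ξ).PosDef) :
    (∀ i j : Fin v, i ≠ j → ApproxDesign.N ξ i j ≤ 0) ∧
    (∀ i j : Fin v, 0 ≤ (ApproxDesign.N ξ)⁻¹ i j) := by
  have hoff : ∀ i j : Fin v, i ≠ j → ξ.N i j ≤ 0 := fun _ _ => ξ.N_apply_nonpos_of_ne
  exact ⟨hoff, hfeas.inv_apply_nonneg hoff⟩
end
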